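/- arXiv:0806.1528 — 2 statements merged into one kernel-verified Lean document; each statement's English description precedes it below -/
import Mathlib

section
/- Let μ be a nontrivial measure on ℝ with compact support, ν_{n+1} the normalized counting measure of the zeros of the monic orthogonal polynomial P_{n+1}, and dμ_n = (n+1)^{−1} K_n(x,x) dμ(x). Then for every ℓ ≥ 0, |∫ x^ℓ dν_{n+1} − ∫ x^ℓ dμ_n| ≤ ℓ ‖M_x‖^ℓ / (n+1); in particular the difference tends to 0 as n → ∞. -/
open MeasureTheory Polynomial

/-- The trace of an endomorphism, computed from a family of vectors and a dual family of
functionals. -/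
theorem trace_eq_sum_of_biorthogonal {K V ι : Type*} [Field K] [AddCommGroup V] [Module K V]
    [Fintype ι] [DecidableEq ι] [Nonempty ι] (b : ι → V) (φ : ι → V →ₗ[K] K)
    (h : ∀ i j, φ i (b j) = if i = j then 1 else 0)
    (hcard : Fintype.card ι = Module.finrank K V) (T : V →ₗ[K] V) :
    LinearMap.trace K V T = ∑ i, φ i (T (b i)) := by
  have hli : LinearIndependent K b := by
    rw [Fintype.linearIndependent_iff]
    intro g hg i
    simpa [h] using congrArg (φ i) hg
  set B := basisOfLinearIndependentOfCardEqFinrank hli hcard with hB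
  have hrepr (v : V) (i : ι) : B.repr v i = φ i v := by
    conv_rhs => rw [← B.sum_repr v]
    simp [hB, h]
  rw [LinearMap.trace_eq_matrix_trace K B, Matrix.trace]
  refine Finset.sum_congr rfl fun i _ => ?_
  rw [Matrix.diag_apply, LinearMap.toMatrix_apply, hrepr]
  simp [hB]

/-- Multiplication by `f` modulo the monic polynomial `P` of degree `n`, as an endomorphism of the
polynomials of degree less than `n`. -/
noncomputable def mulModByMonic {K : Type*} [Field K] {n : ℕ} {P : K[X]} (hP : P.Monic)
    (hdeg : P.natDegree = n) (f : K[X]) : degreeLT K n →ₗ[K] degreeLT K n :=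
  LinearMap.codRestrict (degreeLT K n)
    (modByMonicHom P ∘ₗ LinearMap.mulLeft K f ∘ₗ (degreeLT K n).subtype) fun q => by
      rw [mem_degreeLT]
      have := degree_modByMonic_lt (f * (q : K[X])) hP
      rw [degree_eq_natDegree hP.ne_zero, hdeg] at this
      exact this

/-- The trace of multiplication by `f` modulo `P`, from a family of polynomials with a dual family
of functionals. -/
theorem trace_mulModByMonic {K : Type*} [Field K] {n : ℕ} {P : K[X]} (hP : P.Monic)
    (hdeg : P.natDegree = n + 1) (f : K[X]) (b : Fin (n + 1) → K[X])
    (hb : ∀ i, b i ∈ degreeLT K (n + 1)) (φ : Fin (n + 1) → K[X] →ₗ[K] K)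
    (h : ∀ i j, φ i (b j) = if i = j then 1 else 0) :
    LinearMap.trace K _ (mulModByMonic hP hdeg f) = ∑ i, φ i ((f * b i) %ₘ P) := by
  have hcard : Fintype.card (Fin (n + 1)) = Module.finrank K (degreeLT K (n + 1)) := by
    rw [(degreeLTEquiv K (n + 1)).finrank_eq]; simp
  exact trace_eq_sum_of_biorthogonal (fun i => (⟨b i, hb i⟩ : degreeLT K (n + 1)))
    (fun i => φ i ∘ₗ (degreeLT K (n + 1)).subtype) h hcard (mulModByMonic hP hdeg f)

/-- The functional sending `f` to its coefficient along the monic polynomial `w` in a Newton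
expansion whose next node is `a`. -/
noncomputable def newtonCoeff {K : Type*} [Field K] (w : K[X]) (hw : w.Monic) (a : K) :
    K[X] →ₗ[K] K where
  toFun f := (f /ₘ w).eval a
  map_add' f g := by
    have h := div_modByMonic_unique (f := f + g) (f /ₘ w + g /ₘ w) (f %ₘ w + g %ₘ w) hw
      ⟨by linear_combination modByMonic_add_div f w + modByMonic_add_div g w,
        (degree_add_le _ _).trans_lt
          (max_lt (degree_modByMonic_lt _ hw) (degree_modByMonic_lt _ hw))⟩
    rw [h.1, eval_add]
  map_smul' c f := by
    have h := div_modByMonic_unique (f := c • f) (c • (f /ₘ w)) (c • (f %ₘ w)) hw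
      ⟨by rw [mul_smul_comm, ← smul_add, modByMonic_add_div],
        (degree_smul_le _ _).trans_lt (degree_modByMonic_lt _ hw)⟩
    rw [h.1, eval_smul, RingHom.id_apply]

theorem newtonCoeff_mul {K : Type*} [Field K] {w : K[X]} (hw : w.Monic) (a : K) (g : K[X]) :
    newtonCoeff w hw a (w * g) = g.eval a := by
  change ((w * g) /ₘ w).eval a = _
  rw [mul_divByMonic_cancel_left g hw]

theorem newtonCoeff_eq_zero_of_dvd {K : Type*} [Field K] {w : K[X]} (hw : w.Monic) {a : K}
    {f : K[X]} (h : w * (X - C a) ∣ f) : newtonCoeff w hw a f = 0 := by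
  obtain ⟨g, rfl⟩ := h
  rw [mul_assoc, newtonCoeff_mul]
  simp

/-- The trace of multiplication by `f` modulo `∏ (X - r i)` is the sum of the values `f (r i)`. -/
theorem trace_mulModByMonic_eq_sum_eval {K : Type*} [Field K] {n : ℕ} {P : K[X]} (hP : P.Monic)
    (hdeg : P.natDegree = n + 1) (f : K[X]) (r : Fin (n + 1) → K)
    (hr : P = ∏ i, (X - C (r i))) :
    LinearMap.trace K _ (mulModByMonic hP hdeg f) = ∑ i, f.eval (r i) := by
  set w : Fin (n + 1) → K[X] := fun k => ∏ i ∈ Finset.Iio k, (X - C (r i)) with hw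
  have hwm (k) : (w k).Monic := monic_prod_of_monic _ _ fun i _ => monic_X_sub_C _
  have hwd (k) : (w k).degree = (k : ℕ) := by
    simp [hw, degree_prod]
  have hIic (k : Fin (n + 1)) : w k * (X - C (r k)) = ∏ i ∈ Finset.Iic k, (X - C (r i)) := by
    rw [← Finset.Iio_insert, Finset.prod_insert (by simp), mul_comm]
  have hPdvd (k) : w k * (X - C (r k)) ∣ P := by
    rw [hIic, hr]
    exact Finset.prod_dvd_prod_of_subset _ _ _ (Finset.subset_univ _)
  rw [trace_mulModByMonic hP hdeg f w ?_ (fun k => newtonCoeff (w k) (hwm k) (r k)) ?_]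
  · refine Finset.sum_congr rfl fun k _ => ?_
    rw [modByMonic_eq_sub_mul_div, map_sub,
      newtonCoeff_eq_zero_of_dvd (hwm k) (dvd_mul_of_dvd_left (hPdvd k) _), sub_zero,
      mul_comm, newtonCoeff_mul]
  · intro k
    rw [mem_degreeLT, hwd]
    exact_mod_cast k.2
  · intro i j
    rcases lt_trichotomy i j with hij | rfl | hij
    · rw [if_neg hij.ne]
      refine newtonCoeff_eq_zero_of_dvd _ ?_
      rw [hIic]
      refine Finset.prod_dvd_prod_of_subset _ _ _ fun x hx => ?_
      rw [Finset.mem_Iio]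
      exact (Finset.mem_Iic.1 hx).trans_lt hij
    · have := newtonCoeff_mul (hwm i) (r i) 1
      rw [mul_one] at this
      simp [this]
    · rw [if_neg hij.ne']
      change (w j /ₘ w i).eval (r i) = 0
      rw [(divByMonic_eq_zero_iff (hwm i)).2, eval_zero]
      rw [hwd, hwd]
      exact_mod_cast hij

/-- A positive functional contracts under reduction of `X * g` modulo an orthogonal polynomial. -/
theorem map_modByMonic_sq_le {L : ℝ[X] →ₗ[ℝ] ℝ} (hpos : ∀ f, 0 ≤ L (f * f)) {P : ℝ[X]}
    (hP : P.Monic) {n : ℕ} (hdeg : P.natDegree = n + 1)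
    (horth : ∀ f : ℝ[X], f.natDegree < n + 1 → L (f * P) = 0) {g : ℝ[X]}
    (hg : g.natDegree < n + 1) :
    L ((X * g) %ₘ P * ((X * g) %ₘ P)) ≤ L (X * g * (X * g)) := by
  set q := (X * g) /ₘ P with hq
  set s := (X * g) %ₘ P with hs
  have hqd : q.natDegree = 0 := by
    rw [hq, natDegree_divByMonic _ hP, hdeg]
    have := natDegree_mul_le (p := (X : ℝ[X])) (q := g)
    rw [natDegree_X] at this
    omega
  have hsd : s.natDegree < n + 1 := by
    rw [← hdeg]
    exact natDegree_modByMonic_lt _ hP fun h => by simp [h] at hdeg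
  have hdecomp : s + P * q = X * g := modByMonic_add_div _ _
  have hcross : L (s * q * P) = 0 := horth _ (natDegree_mul_le.trans_lt (by omega))
  have hexp : X * g * (X * g) = s * s + (2 : ℝ) • (s * q * P) + P * q * (P * q) := by
    rw [← hdecomp, smul_eq_C_mul, map_ofNat]
    ring
  rw [hexp, map_add, map_add, map_smul, hcross, smul_zero, add_zero]
  linarith [hpos (P * q)]

/-- Powers of the compressed multiplication operator are bounded by the powers of `R`. -/
theorem map_pow_modByMonic_sq_le {L : ℝ[X] →ₗ[ℝ] ℝ} (hpos : ∀ f, 0 ≤ L (f * f)) {R : ℝ}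
    (hbound : ∀ f, L (X * f * (X * f)) ≤ R ^ 2 * L (f * f)) {P : ℝ[X]}
    (hP : P.Monic) {n : ℕ} (hdeg : P.natDegree = n + 1)
    (horth : ∀ f : ℝ[X], f.natDegree < n + 1 → L (f * P) = 0) {g : ℝ[X]}
    (hg : g.natDegree < n + 1) (m : ℕ) :
    L ((X ^ m * g) %ₘ P * ((X ^ m * g) %ₘ P)) ≤ (R ^ m) ^ 2 * L (g * g) := by
  induction m with
  | zero =>
    have : g %ₘ P = g := (modByMonic_eq_self_iff hP).2 <| degree_lt_degree (by omega)
    simp [this]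
  | succ m ih =>
    set s := (X ^ m * g) %ₘ P with hs
    have hsd : s.natDegree < n + 1 := by
      rw [← hdeg]
      exact natDegree_modByMonic_lt _ hP fun h => by simp [h] at hdeg
    have hstep : (X ^ (m + 1) * g) %ₘ P = (X * s) %ₘ P := by
      refine modByMonic_eq_of_dvd_sub hP ⟨X * ((X ^ m * g) /ₘ P), ?_⟩
      rw [hs, modByMonic_eq_sub_mul_div]
      ring
    rw [hstep]
    calc _ ≤ L (X * s * (X * s)) := map_modByMonic_sq_le hpos hP hdeg horth hsd
      _ ≤ R ^ 2 * L (s * s) := hbound s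
      _ ≤ R ^ 2 * ((R ^ m) ^ 2 * L (g * g)) := by gcongr
      _ = _ := by ring

/-- Cauchy–Schwarz for a positive functional and a normalized first argument. -/
theorem abs_map_mul_le {L : ℝ[X] →ₗ[ℝ] ℝ} (hpos : ∀ f, 0 ≤ L (f * f)) {f g : ℝ[X]}
    (hf : L (f * f) = 1) {c : ℝ} (hc : 0 ≤ c) (hg : L (g * g) ≤ c ^ 2) : |L (f * g)| ≤ c := by
  have h := hpos (g - L (f * g) • f)
  have hexp : (g - L (f * g) • f) * (g - L (f * g) • f) =
      g * g - (2 * L (f * g)) • (f * g) + (L (f * g) ^ 2) • (f * f) := by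
    simp only [smul_eq_C_mul, map_mul, map_pow, map_ofNat]
    ring
  rw [hexp, map_add, map_sub, map_smul, map_smul, hf, smul_eq_mul, smul_eq_mul] at h
  exact abs_le_of_sq_le_sq (by linarith) hc

/-- Diagonal entries of the powers of the truncated and of the full multiplication operator
agree away from the truncation corner. -/
theorem map_mul_modByMonic_eq {L : ℝ[X] →ₗ[ℝ] ℝ} {P : ℝ[X]} (hP : P.Monic) {n : ℕ}
    (hdeg : P.natDegree = n + 1)
    (horth : ∀ f : ℝ[X], f.natDegree < n + 1 → L (f * P) = 0) {q : ℝ[X]} {ℓ : ℕ}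
    (hq : q.natDegree < n + 1) (hlt : ℓ + 2 * q.natDegree < 2 * (n + 1)) :
    L (q * ((X ^ ℓ * q) %ₘ P)) = L (X ^ ℓ * q * q) := by
  have hd : (q * ((X ^ ℓ * q) /ₘ P)).natDegree < n + 1 := by
    refine natDegree_mul_le.trans_lt ?_
    rw [natDegree_divByMonic _ hP, hdeg]
    have := natDegree_mul_le (p := (X : ℝ[X]) ^ ℓ) (q := q)
    rw [natDegree_X_pow] at this
    omega
  have hexp : q * ((X ^ ℓ * q) %ₘ P) = X ^ ℓ * q * q - q * ((X ^ ℓ * q) /ₘ P) * P := by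
    rw [modByMonic_eq_sub_mul_div]
    ring
  rw [hexp, map_sub, horth _ hd, sub_zero]

/-- Moment comparison between the zeros of an orthogonal polynomial and the diagonal of the
Christoffel–Darboux kernel, for a positive functional. -/
theorem abs_sum_pow_sub_sum_map_le {L : ℝ[X] →ₗ[ℝ] ℝ} (hpos : ∀ f, 0 ≤ L (f * f)) {R : ℝ}
    (hR : 0 ≤ R) (hbound : ∀ f, L (X * f * (X * f)) ≤ R ^ 2 * L (f * f))
    (hdiag : ∀ (m : ℕ) (f : ℝ[X]), |L (X ^ m * f * f)| ≤ R ^ m * L (f * f))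
    {p : ℕ → ℝ[X]} (hpdeg : ∀ j, (p j).natDegree = j)
    (hp : ∀ j k, L (p j * p k) = if j = k then 1 else 0) {P : ℝ[X]} (hP : P.Monic) {n : ℕ}
    (hdeg : P.natDegree = n + 1)
    (horth : ∀ f : ℝ[X], f.natDegree < n + 1 → L (f * P) = 0) (r : Fin (n + 1) → ℝ)
    (hr : P = ∏ i, (X - C (r i))) (ℓ : ℕ) :
    |∑ i, r i ^ ℓ - ∑ j ∈ Finset.range (n + 1), L (X ^ ℓ * p j * p j)| ≤ ℓ * R ^ ℓ := by
  have htrace : ∑ i, r i ^ ℓ =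
      ∑ j ∈ Finset.range (n + 1), L (p j * ((X ^ ℓ * p j) %ₘ P)) := by
    rw [Finset.sum_range (fun j => L (p j * ((X ^ ℓ * p j) %ₘ P)))]
    have h1 := trace_mulModByMonic_eq_sum_eval hP hdeg (X ^ ℓ) r hr
    have h2 := trace_mulModByMonic hP hdeg (X ^ ℓ) (fun j => p j)
      (fun j => mem_degreeLT.2 <| (degree_le_natDegree).trans_lt <| by
        rw [hpdeg]; exact_mod_cast j.2)
      (fun j => L ∘ₗ LinearMap.mulLeft ℝ (p j))
      (fun i j => by simp [hp, Fin.ext_iff])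
    rw [h1] at h2
    simpa using h2
  have hterm : ∀ j ∈ Finset.range (n + 1),
      |L (p j * ((X ^ ℓ * p j) %ₘ P)) - L (X ^ ℓ * p j * p j)| ≤
        if n + 1 - ℓ / 2 ≤ j then 2 * R ^ ℓ else 0 := by
    intro j hj
    rw [Finset.mem_range] at hj
    have hjj : L (p j * p j) = 1 := by simp [hp]
    have hjn : (p j).natDegree < n + 1 := by rwa [hpdeg]
    split_ifs with hcorner
    · have h1 : |L (p j * ((X ^ ℓ * p j) %ₘ P))| ≤ R ^ ℓ := by
        refine abs_map_mul_le hpos hjj (by positivity) ?_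
        have := map_pow_modByMonic_sq_le hpos hbound hP hdeg horth hjn ℓ
        rwa [hjj, mul_one] at this
      have h2 := hdiag ℓ (p j)
      rw [hjj, mul_one] at h2
      have h3 := abs_sub (L (p j * ((X ^ ℓ * p j) %ₘ P))) (L (X ^ ℓ * p j * p j))
      linarith
    · rw [map_mul_modByMonic_eq hP hdeg horth hjn (by rw [hpdeg]; omega), sub_self, abs_zero]
  have hcard : (((Finset.range (n + 1)).filter (n + 1 - ℓ / 2 ≤ ·)).card : ℝ) * 2 ≤ ℓ := by
    have hsub : (Finset.range (n + 1)).filter (n + 1 - ℓ / 2 ≤ ·) ⊆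
        Finset.Ico (n + 1 - ℓ / 2) (n + 1) := by
      intro j hj
      simp only [Finset.mem_filter, Finset.mem_range, Finset.mem_Ico] at hj ⊢
      omega
    have := Finset.card_le_card hsub
    rw [Nat.card_Ico] at this
    have h2 : ((Finset.range (n + 1)).filter (n + 1 - ℓ / 2 ≤ ·)).card * 2 ≤ ℓ := by omega
    exact_mod_cast h2
  rw [htrace, ← Finset.sum_sub_distrib]
  calc _ ≤ ∑ j ∈ Finset.range (n + 1), if n + 1 - ℓ / 2 ≤ j then 2 * R ^ ℓ else 0 :=
        (Finset.abs_sum_le_sum_abs _ _).trans (Finset.sum_le_sum hterm)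
    _ = (((Finset.range (n + 1)).filter (n + 1 - ℓ / 2 ≤ ·)).card : ℝ) * 2 * R ^ ℓ := by
        rw [← Finset.sum_filter, Finset.sum_const, nsmul_eq_mul, mul_assoc]
    _ ≤ ℓ * R ^ ℓ := by gcongr

theorem integrable_eval_of_integrable_abs_pow {μ : Measure ℝ}
    (hmom : ∀ k : ℕ, Integrable (fun t => |t| ^ k) μ) (f : ℝ[X]) :
    Integrable (fun t => f.eval t) μ := by
  induction f using Polynomial.induction_on' with
  | add f g hf hg => simpa only [eval_add] using hf.fun_add hg
  | monomial k a =>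
    have : Integrable (fun t : ℝ => t ^ k) μ :=
      (hmom k).mono' (by fun_prop) (.of_forall fun t => by simp)
    simpa using this.const_mul a

/-- Integration of polynomials against a measure with finite moments. -/
noncomputable def momentFunctional (μ : Measure ℝ)
    (hmom : ∀ k : ℕ, Integrable (fun t => |t| ^ k) μ) : ℝ[X] →ₗ[ℝ] ℝ where
  toFun f := ∫ t, f.eval t ∂μ
  map_add' f g := by
    simp only [eval_add]
    exact integral_add (integrable_eval_of_integrable_abs_pow hmom f)
      (integrable_eval_of_integrable_abs_pow hmom g)
  map_smul' c f := by
    simp only [eval_smul, smul_eq_mul, RingHom.id_apply]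
    exact integral_const_mul c _

/-- Comparison of moments of the zero counting measure of `P_{n+1}` with those of
`(n+1)⁻¹ K_n(x,x) dμ(x)`: they differ by at most `ℓ R^ℓ/(n+1)`, where `R` bounds
the support of `μ` (the norm of the multiplication operator `M_x`). -/
theorem weak_limit_moment_comparison
    (μ : Measure ℝ) [IsFiniteMeasure μ]
    (R : ℝ) (hR0 : 0 ≤ R) (hR : ∀ᵐ t ∂μ, |t| ≤ R)
    (hmom : ∀ k : ℕ, Integrable (fun t => |t| ^ k) μ)
    (p : ℕ → Polynomial ℝ)
    (hdeg : ∀ j, (p j).natDegree = j)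
    (hortho : ∀ j k, ∫ t, (p j).eval t * (p k).eval t ∂μ = if j = k then 1 else 0)
    (n : ℕ)
    (P : Polynomial ℝ)
    (hPmonic : P.Monic)
    (hPdeg : P.natDegree = n + 1)
    (hPorth : ∀ j < n + 1, ∫ t, t ^ j * P.eval t ∂μ = 0)
    (r : Fin (n + 1) → ℝ)
    (hroots : P = ∏ i : Fin (n + 1), (Polynomial.X - Polynomial.C (r i)))
    (ℓ : ℕ) :
    |(n + 1 : ℝ)⁻¹ * ∑ i : Fin (n + 1), (r i) ^ ℓ
        - (n + 1 : ℝ)⁻¹ * ∑ j ∈ Finset.range (n + 1),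
            ∫ t, t ^ ℓ * ((p j).eval t) ^ 2 ∂μ|
      ≤ (ℓ : ℝ) * R ^ ℓ / (n + 1) := by
  set L := momentFunctional μ hmom
  have hL (f : ℝ[X]) : L f = ∫ t, f.eval t ∂μ := rfl
  have hint := integrable_eval_of_integrable_abs_pow hmom
  have hpos (f : ℝ[X]) : 0 ≤ L (f * f) := by
    rw [hL]
    exact integral_nonneg fun t => by simpa using mul_self_nonneg (f.eval t)
  have hdiag (m : ℕ) (f : ℝ[X]) : |L (X ^ m * f * f)| ≤ R ^ m * L (f * f) := by
    rw [hL, hL, ← integral_const_mul, ← Real.norm_eq_abs]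
    refine norm_integral_le_of_norm_le ((hint (f * f)).const_mul _) ?_
    filter_upwards [hR] with t ht
    simp only [eval_mul, eval_pow, eval_X, norm_mul, norm_pow, Real.norm_eq_abs]
    rw [mul_assoc, abs_mul_abs_self]
    exact mul_le_mul_of_nonneg_right (pow_le_pow_left₀ (abs_nonneg t) ht m)
      (mul_self_nonneg _)
  have hbound (f : ℝ[X]) : L (X * f * (X * f)) ≤ R ^ 2 * L (f * f) := by
    rw [show X * f * (X * f) = X ^ 2 * f * f by ring]
    exact (le_abs_self _).trans (hdiag 2 f)
  have hp (j k : ℕ) : L (p j * p k) = if j = k then 1 else 0 := by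
    simpa [hL] using hortho j k
  have horth (f : ℝ[X]) (hf : f.natDegree < n + 1) : L (f * P) = 0 := by
    rw [f.as_sum_range, Finset.sum_mul, map_sum]
    refine Finset.sum_eq_zero fun j hj => ?_
    rw [← C_mul_X_pow_eq_monomial, mul_assoc, ← smul_eq_C_mul, map_smul, hL]
    simp [hPorth j ((Finset.mem_range.1 hj).trans_le hf)]
  have hmain := abs_sum_pow_sub_sum_map_le hpos hR0 hbound hdiag hdeg hp hPmonic hPdeg horth r
    hroots ℓ
  have hkernel (j : ℕ) : ∫ t, t ^ ℓ * ((p j).eval t) ^ 2 ∂μ = L (X ^ ℓ * p j * p j) := by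
    rw [hL]
    exact integral_congr_ae (.of_forall fun t => by simp; ring)
  simp only [hkernel]
  rw [← mul_sub, abs_mul, abs_of_nonneg (by positivity), inv_mul_eq_div]
  gcongr
end

section
/- Let f be an entire function, real on ℝ, with f(0) = 1, |f(x)| ≤ 1 for all real x, ∫_ℝ |f(x)|² dx ≤ 1, and |f(z)| ≤ D e^{(π+ε)|Im z|} for every ε > 0 (suitable D depending on ε). Then f(z) = sin(πz)/(πz). -/
open MeasureTheory Complex
open Filter Topology FourierTransform Set

/-- The integral of an entire function over a horizontal line does not depend on the line, if the
function decays quadratically in the strip. -/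
theorem integral_eq_integral_add_mul_I {G : ℂ → ℂ} (hG : Differentiable ℂ G) {C y : ℝ}
    (hC : ∀ z : ℂ, |z.im| ≤ |y| → ‖G z‖ ≤ C * (1 + z.re ^ 2)⁻¹) :
    ∫ x : ℝ, G x = ∫ x : ℝ, G (x + y * I) := by
  have hline : ∀ t : ℝ, |t| ≤ |y| → Integrable (fun x : ℝ ↦ G (x + t * I)) := fun t ht ↦ by
    refine (integrable_inv_one_add_sq.const_mul C).mono'
      (hG.continuous.comp (by fun_prop)).aestronglyMeasurable (.of_forall fun x ↦ ?_)
    simpa using hC (x + t * I) (by simpa using ht)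
  have hvert : ∀ s : ℝ, ‖∫ t in (0 : ℝ)..y, G (s + t * I)‖ ≤ C * (1 + s ^ 2)⁻¹ * |y| := fun s ↦ by
    refine (intervalIntegral.norm_integral_le_of_norm_le_const (C := C * (1 + s ^ 2)⁻¹)
      fun t ht ↦ ?_).trans_eq (by simp)
    have ht' : |t| ≤ |y| := by
      simpa using abs_sub_left_of_mem_uIcc (uIoc_subset_uIcc ht)
    simpa using hC (s + t * I) (by simpa using ht')
  have hdecay : Tendsto (fun T : ℝ ↦ C * (1 + T ^ 2)⁻¹ * |y|) atTop (𝓝 0) := by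
    have : Tendsto (fun T : ℝ ↦ 1 + T ^ 2) atTop atTop :=
      tendsto_atTop_add_const_left _ _ (tendsto_pow_atTop two_ne_zero)
    simpa using (this.inv_tendsto_atTop.const_mul C).mul_const |y|
  have hright : Tendsto (fun T : ℝ ↦ ∫ t in (0 : ℝ)..y, G (T + t * I)) atTop (𝓝 0) :=
    squeeze_zero_norm hvert hdecay
  have hleft : Tendsto (fun T : ℝ ↦ ∫ t in (0 : ℝ)..y, G ((-T : ℝ) + t * I)) atTop (𝓝 0) :=
    squeeze_zero_norm (fun T ↦ (hvert (-T)).trans_eq (by simp)) hdecay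
  have hbottom : Tendsto (fun T : ℝ ↦ ∫ x in -T..T, G x) atTop (𝓝 (∫ x : ℝ, G x)) :=
    intervalIntegral_tendsto_integral (by simpa using hline 0 (by simp))
      tendsto_neg_atTop_atBot tendsto_id
  have htop : Tendsto (fun T : ℝ ↦ ∫ x in -T..T, G (x + y * I)) atTop
      (𝓝 (∫ x : ℝ, G (x + y * I))) :=
    intervalIntegral_tendsto_integral (hline y le_rfl) tendsto_neg_atTop_atBot tendsto_id
  have hlim := ((hbottom.sub htop).add (hright.const_mul I)).sub (hleft.const_mul I)
  have hzero : ∀ T : ℝ, (∫ x in -T..T, G x) - (∫ x in -T..T, G (x + y * I)) +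
      I * (∫ t in (0 : ℝ)..y, G (T + t * I)) -
      I * (∫ t in (0 : ℝ)..y, G ((-T : ℝ) + t * I)) = 0 := fun T ↦ by
    have := integral_boundary_rect_eq_zero_of_differentiableOn G ((-T : ℝ) : ℂ) (T + y * I)
      hG.differentiableOn
    simpa using this
  simp only [hzero] at hlim
  have := tendsto_nhds_unique hlim tendsto_const_nhds
  simpa [sub_eq_zero] using this

/-- The easy half of Paley–Wiener: the Fourier transform of a quadratically decaying entire function
of exponential type `a` vanishes outside `[-a / (2π), a / (2π)]`. -/
theorem fourier_eq_zero_of_exponential_type {g : ℂ → ℂ} (hg : Differentiable ℂ g) {C a : ℝ}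
    (hC : ∀ z : ℂ, ‖g z‖ ≤ C * Real.exp (a * |z.im|) * (1 + z.re ^ 2)⁻¹) (ha : 0 ≤ a) {ξ : ℝ}
    (hξ : a < 2 * Real.pi * |ξ|) : 𝓕 (fun x : ℝ ↦ g x) ξ = 0 := by
  have hC0 : 0 ≤ C := by simpa using (norm_nonneg _).trans (hC 0)
  set G : ℂ → ℂ := fun z ↦ exp (-(2 * Real.pi * ξ) * I * z) * g z with hGdef
  have hG : Differentiable ℂ G := by fun_prop
  have hGC : ∀ z : ℂ, ‖G z‖ ≤
      C * Real.exp (a * |z.im| + 2 * Real.pi * ξ * z.im) * (1 + z.re ^ 2)⁻¹ := fun z ↦ by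
    rw [hGdef, norm_mul, Complex.norm_exp, Real.exp_add]
    refine (mul_le_mul_of_nonneg_left (hC z) (Real.exp_nonneg _)).trans_eq ?_
    have : (-(2 * Real.pi * ξ : ℂ) * I * z).re = 2 * Real.pi * ξ * z.im := by simp
    rw [this]; ring
  have hF : 𝓕 (fun x : ℝ ↦ g x) ξ = ∫ x : ℝ, G x := by
    rw [Real.fourier_real_eq_integral_exp_smul]
    refine integral_congr_ae (.of_forall fun x ↦ ?_)
    simp only [hGdef, smul_eq_mul]
    congr 2
    push_cast
    ring
  have hbound : ∀ y : ℝ, ‖𝓕 (fun x : ℝ ↦ g x) ξ‖ ≤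
      C * Real.exp (a * |y| + 2 * Real.pi * ξ * y) * Real.pi := fun y ↦ by
    rw [hF, integral_eq_integral_add_mul_I hG (y := y)
      (C := C * Real.exp (a * |y| + 2 * Real.pi * |ξ| * |y|)), ← integral_univ_inv_one_add_sq,
      ← integral_const_mul]
    · refine norm_integral_le_of_norm_le (integrable_inv_one_add_sq.const_mul _)
        (.of_forall fun x ↦ ?_)
      simpa using hGC (x + y * I)
    · intro z hz
      refine (hGC z).trans ?_
      have : 2 * Real.pi * ξ * z.im ≤ 2 * Real.pi * |ξ| * |y| := by
        have h1 : ξ * z.im ≤ |ξ| * |y| := (le_abs_self _).trans <| by rw [abs_mul]; gcongr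
        nlinarith [Real.pi_pos]
      gcongr
  have hlim : Tendsto (fun s : ℝ ↦ C * Real.exp (-((2 * Real.pi * |ξ| - a) * s)) * Real.pi)
      atTop (𝓝 0) := by
    have : Tendsto (fun s : ℝ ↦ (2 * Real.pi * |ξ| - a) * s) atTop atTop :=
      tendsto_id.const_mul_atTop (by linarith)
    simpa using ((Real.tendsto_exp_neg_atTop_nhds_zero.comp this).const_mul C).mul_const Real.pi
  refine norm_le_zero_iff.mp (ge_of_tendsto hlim ?_)
  filter_upwards [eventually_ge_atTop 0] with s hs
  rcases le_total 0 ξ with h | h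
  · refine (hbound (-s)).trans_eq ?_
    rw [abs_neg, abs_of_nonneg hs, abs_of_nonneg h]
    ring_nf
  · refine (hbound s).trans_eq ?_
    rw [abs_of_nonneg hs, abs_of_nonpos h]
    ring_nf

theorem fourier_indicator_Icc {b : ℝ} (hb : 0 ≤ b) (x : ℝ) :
    𝓕 ((Icc (-(b / (2 * Real.pi))) (b / (2 * Real.pi))).indicator fun _ ↦ (1 : ℂ)) x =
      (b / Real.pi * Real.sinc (b * x) : ℝ) := by
  have hpi := Real.pi_pos
  set B := b / (2 * Real.pi) with hB
  have hB0 : 0 ≤ B := by positivity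
  have hbB : b = 2 * Real.pi * B := by rw [hB]; field_simp
  rw [Real.fourier_real_eq_integral_exp_smul]
  have : (fun v : ℝ ↦ exp (↑(-2 * Real.pi * v * x) * I) •
      (Icc (-B) B).indicator (fun _ ↦ (1 : ℂ)) v) =
      (Icc (-B) B).indicator fun v : ℝ ↦ exp (↑(-2 * Real.pi * v * x) * I) := by
    ext v
    by_cases hv : v ∈ Icc (-B) B <;> simp [hv]
  rw [this, integral_indicator measurableSet_Icc, integral_Icc_eq_integral_Ioc,
    ← intervalIntegral.integral_of_le (by linarith)]
  rcases eq_or_ne x 0 with rfl | hx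
  · simp only [mul_zero, ofReal_zero, zero_mul, Complex.exp_zero, Real.sinc_zero, mul_one,
      intervalIntegral.integral_const]
    rw [hbB]
    simp
    field_simp
    ring
  · have hc : (-2 * Real.pi * x) ≠ 0 := by simp [hx, hpi.ne']
    have := intervalIntegral.integral_comp_mul_left (a := -B) (b := B)
      (fun t : ℝ ↦ exp (t * I)) hc
    have h2 : -2 * Real.pi * x * B = -(b * x) := by rw [hbB]; ring
    have h3 : -2 * Real.pi * x * -B = b * x := by rw [hbB]; ring
    rw [h2, h3, intervalIntegral.integral_symm (-(b * x)) (b * x), integral_exp_mul_I_eq_sinc] at this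
    convert this using 1
    · congr 1; ext v; congr 2; push_cast; ring
    · rw [Complex.real_smul]
      push_cast
      have : (Real.pi : ℂ) ≠ 0 := by simp [hpi.ne']
      have : (x : ℂ) ≠ 0 := by simpa using hx
      field_simp

theorem eq_integral_mul_sinc_of_decay {g : ℂ → ℂ} (hg : Differentiable ℂ g) {C a b : ℝ}
    (hC : ∀ z : ℂ, ‖g z‖ ≤ C * Real.exp (a * |z.im|) * (1 + z.re ^ 2)⁻¹) (ha : 0 ≤ a)
    (hab : a < b) :
    ∫ x : ℝ, g x * (b / Real.pi * Real.sinc (b * x) : ℝ) = g 0 := by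
  have hpi := Real.pi_pos
  have hcont : Continuous fun x : ℝ ↦ g x := hg.continuous.comp continuous_ofReal
  have hint : Integrable fun x : ℝ ↦ g x :=
    (integrable_inv_one_add_sq.const_mul C).mono' hcont.aestronglyMeasurable
      (.of_forall fun x ↦ by simpa using hC x)
  set S := Icc (-(b / (2 * Real.pi))) (b / (2 * Real.pi)) with hS
  have hzero : ∀ ξ ∉ S, 𝓕 (fun x : ℝ ↦ g x) ξ = 0 := fun ξ hξ ↦ by
    refine fourier_eq_zero_of_exponential_type hg hC ha (hab.trans ?_)
    rw [hS, mem_Icc, ← abs_le, not_le, div_lt_iff₀ (by positivity)] at hξ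
    linarith
  have hFcont : Continuous (𝓕 fun x : ℝ ↦ g x) :=
    VectorFourier.fourierIntegral_continuous Real.continuous_fourierChar
      (by exact continuous_inner) hint
  have hFint : Integrable (𝓕 fun x : ℝ ↦ g x) :=
    hFcont.integrable_of_hasCompactSupport (HasCompactSupport.intro isCompact_Icc hzero)
  have hinv := congrFun (hcont.fourierInv_fourier_eq hint hFint) 0
  rw [Real.fourierInv_eq'] at hinv
  have hflip := VectorFourier.integral_fourierIntegral_smul_eq_flip (L := innerₗ ℝ)
    (g := S.indicator fun _ ↦ (1 : ℂ)) (e := Real.fourierChar) (μ := volume) (ν := volume)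
    Real.continuous_fourierChar
    (by exact continuous_inner) hint
    ((integrable_indicator_iff measurableSet_Icc).mpr (integrableOn_const (by simp)))
  rw [flip_innerₗ] at hflip
  change ∫ ξ : ℝ, 𝓕 (fun x : ℝ ↦ g x) ξ • S.indicator (fun _ ↦ (1 : ℂ)) ξ =
    ∫ x : ℝ, g x • 𝓕 (S.indicator fun _ ↦ (1 : ℂ)) x at hflip
  simp only [S, fourier_indicator_Icc (ha.trans hab.le)] at hflip
  rw [← hS] at hflip
  simp only [smul_eq_mul] at hflip
  rw [← hflip]
  simp only [ofReal_zero] at hinv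
  rw [← hinv]
  refine integral_congr_ae (.of_forall fun ξ ↦ ?_)
  by_cases hξ : ξ ∈ S
  · simp [hξ]
  · simp [hξ, hzero ξ hξ]

/-- The entire function `z ↦ sin z / z`, with value `1` at `0`. -/
noncomputable def entireSinc : ℂ → ℂ := dslope Complex.sin 0

theorem entireSinc_zero : entireSinc 0 = 1 := by
  simp [entireSinc, Complex.deriv_sin]

theorem mul_entireSinc (z : ℂ) : z * entireSinc z = Complex.sin z := by
  simpa using! sub_smul_dslope Complex.sin 0 z

theorem entireSinc_ofReal (x : ℝ) : entireSinc x = Real.sinc x := by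
  rcases eq_or_ne x 0 with rfl | hx
  · simp [entireSinc_zero]
  · have hx' : (x : ℂ) ≠ 0 := by simpa using hx
    rw [Real.sinc_of_ne_zero hx]
    push_cast
    rw [← mul_entireSinc, mul_div_cancel_left₀ _ hx']

theorem differentiable_entireSinc : Differentiable ℂ entireSinc := by
  rw [← differentiableOn_univ]
  exact (differentiableOn_dslope univ_mem).mpr differentiable_sin.differentiableOn

theorem norm_exp_mul_I_le (z : ℂ) : ‖exp (z * I)‖ ≤ Real.exp |z.im| := by
  rw [Complex.norm_exp]
  simpa using neg_le_abs z.im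

theorem norm_exp_neg_mul_I_le (z : ℂ) : ‖exp (-z * I)‖ ≤ Real.exp |z.im| := by
  simpa using norm_exp_mul_I_le (-z)

theorem norm_sin_le_exp_abs_im (z : ℂ) : ‖Complex.sin z‖ ≤ Real.exp |z.im| := by
  rw [Complex.sin, norm_div, norm_mul, norm_I, mul_one, Complex.norm_two]
  have := (norm_sub_le (exp (-z * I)) (exp (z * I))).trans
    (add_le_add (norm_exp_neg_mul_I_le z) (norm_exp_mul_I_le z))
  linarith

theorem norm_cos_le_exp_abs_im (z : ℂ) : ‖Complex.cos z‖ ≤ Real.exp |z.im| := by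
  rw [Complex.cos, norm_div, Complex.norm_two]
  have := (norm_add_le (exp (z * I)) (exp (-z * I))).trans
    (add_le_add (norm_exp_mul_I_le z) (norm_exp_neg_mul_I_le z))
  linarith

theorem norm_entireSinc_le (z : ℂ) : ‖entireSinc z‖ ≤ Real.exp |z.im| := by
  rcases eq_or_ne z 0 with rfl | hz
  · simp [entireSinc_zero]
  have hseg : ∀ w ∈ segment ℝ 0 z, ‖Complex.cos w‖ ≤ Real.exp |z.im| := by
    rintro w ⟨s, t, hs, ht, hst, rfl⟩
    refine (norm_cos_le_exp_abs_im _).trans (Real.exp_le_exp.mpr ?_)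
    have : |t * z.im| ≤ |z.im| := by
      rw [abs_mul, abs_of_nonneg ht]
      exact mul_le_of_le_one_left (abs_nonneg _) (by linarith)
    simpa using this
  have := (convex_segment (𝕜 := ℝ) 0 z).norm_image_sub_le_of_norm_hasDerivWithin_le
    (fun w _ ↦ (Complex.hasDerivAt_sin w).hasDerivWithinAt) hseg
    (left_mem_segment ℝ 0 z) (right_mem_segment ℝ 0 z)
  rw [Complex.sin_zero, sub_zero, sub_zero, ← mul_entireSinc, norm_mul, mul_comm] at this
  exact le_of_mul_le_mul_right this (norm_pos_iff.mpr hz)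

theorem norm_entireSinc_sq_le (z : ℂ) :
    ‖entireSinc z‖ ^ 2 * (1 + z.re ^ 2) ≤ 2 * Real.exp (2 * |z.im|) := by
  have h1 := norm_entireSinc_le z
  have h2 : |z.re| * ‖entireSinc z‖ ≤ Real.exp |z.im| :=
    (mul_le_mul_of_nonneg_right (abs_re_le_norm z) (norm_nonneg _)).trans <| by
      rw [← norm_mul, mul_entireSinc]
      exact norm_sin_le_exp_abs_im z
  have h1' := pow_le_pow_left₀ (norm_nonneg _) h1 2
  have h2' := pow_le_pow_left₀ (by positivity) h2 2
  rw [mul_pow, sq_abs] at h2'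
  rw [two_mul |z.im|, Real.exp_add, ← sq]
  linarith

theorem sinc_sq_le (x : ℝ) : Real.sinc x ^ 2 * (1 + x ^ 2) ≤ 2 := by
  simpa [entireSinc_ofReal] using norm_entireSinc_sq_le x

theorem sq_div_pi_mul_sinc_le {b : ℝ} (hb : 1 ≤ b) (hb' : b ≤ 2 * Real.pi) (x : ℝ) :
    (b / Real.pi * Real.sinc (b * x)) ^ 2 ≤ 8 * (1 + x ^ 2)⁻¹ := by
  have hpi := Real.pi_pos
  rw [← div_eq_mul_inv, le_div_iff₀ (by positivity), mul_pow, mul_assoc]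
  have h1 : (b / Real.pi) ^ 2 ≤ 2 ^ 2 := by
    have : b / Real.pi ≤ 2 := by rwa [div_le_iff₀ hpi]
    gcongr
  have h2 : Real.sinc (b * x) ^ 2 * (1 + x ^ 2) ≤ 2 := by
    refine le_trans ?_ (sinc_sq_le (b * x))
    have : x ^ 2 ≤ (b * x) ^ 2 := by
      rw [mul_pow]
      exact le_mul_of_one_le_left (sq_nonneg x) (one_le_pow₀ hb)
    gcongr
  calc _ ≤ (2 : ℝ) ^ 2 * 2 := by gcongr
    _ = 8 := by norm_num

theorem norm_mul_entireSinc_sq_le {f : ℂ → ℂ} {D a δ : ℝ} (hδ : 0 < δ) (hδ' : δ ≤ 1)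
    (hf : ∀ z : ℂ, ‖f z‖ ≤ D * Real.exp (a * |z.im|)) (z : ℂ) :
    ‖f z * entireSinc (δ * z) ^ 2‖ ≤
      D * 2 / δ ^ 2 * Real.exp ((a + 2 * δ) * |z.im|) * (1 + z.re ^ 2)⁻¹ := by
  have hD : 0 ≤ D := by simpa using (norm_nonneg _).trans (hf 0)
  have h := norm_entireSinc_sq_le (δ * z)
  simp only [re_ofReal_mul, im_ofReal_mul, abs_mul, abs_of_pos hδ] at h
  have h' : ‖entireSinc (δ * z)‖ ^ 2 ≤
      2 / δ ^ 2 * Real.exp (2 * δ * |z.im|) * (1 + z.re ^ 2)⁻¹ := by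
    rw [← div_eq_mul_inv, le_div_iff₀ (by positivity), div_mul_eq_mul_div,
      le_div_iff₀ (by positivity), mul_assoc 2 δ]
    refine le_trans ?_ h
    rw [mul_assoc]
    gcongr
    nlinarith [pow_le_one₀ hδ.le hδ' (n := 2)]
  rw [norm_mul, norm_pow]
  refine (mul_le_mul (hf z) h' (by positivity) (by positivity)).trans_eq ?_
  rw [show (a + 2 * δ) * |z.im| = a * |z.im| + 2 * δ * |z.im| by ring, Real.exp_add]
  ring

/-- The Paley–Wiener space of type `π` has reproducing kernel `sinc`. -/
theorem integral_mul_sinc_eq {f : ℂ → ℂ} (hf : Differentiable ℂ f)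
    (hint : Integrable fun x : ℝ ↦ ‖f x‖ ^ 2)
    (hgrowth : ∀ ε : ℝ, 0 < ε → ∃ D : ℝ, ∀ z : ℂ,
      ‖f z‖ ≤ D * Real.exp ((Real.pi + ε) * |z.im|)) :
    ∫ x : ℝ, f x * (Real.sinc (Real.pi * x) : ℝ) = f 0 := by
  have hpi := Real.pi_pos
  have hfc := hf.continuous
  have hsc := differentiable_entireSinc.continuous
  set F : ℝ → ℝ → ℂ := fun δ x ↦ f x * entireSinc (δ * x) ^ 2 *
    ((Real.pi + 4 * δ) / Real.pi * Real.sinc ((Real.pi + 4 * δ) * x) : ℝ) with hF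
  have hsmall : ∀ᶠ δ : ℝ in 𝓝[>] 0, 0 < δ ∧ δ < 1 / 2 :=
    Ioo_mem_nhdsGT (by norm_num)
  have hF0 : ∀ᶠ δ : ℝ in 𝓝[>] 0, ∫ x : ℝ, F δ x = f 0 := by
    filter_upwards [hsmall] with δ ⟨hδ, hδ'⟩
    obtain ⟨D, hD⟩ := hgrowth δ hδ
    have hg : Differentiable ℂ fun z ↦ f z * entireSinc (δ * z) ^ 2 :=
      hf.mul ((differentiable_entireSinc.comp (by fun_prop)).pow 2)
    simpa [hF, entireSinc_zero] using eq_integral_mul_sinc_of_decay hg (b := Real.pi + 4 * δ)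
      (norm_mul_entireSinc_sq_le hδ (by linarith) hD) (by positivity) (by linarith)
  have hlim : Tendsto (fun δ ↦ ∫ x : ℝ, F δ x) (𝓝[>] 0)
      (𝓝 (∫ x : ℝ, f x * (Real.sinc (Real.pi * x) : ℝ))) := by
    refine tendsto_integral_filter_of_dominated_convergence
      (fun x ↦ ‖f x‖ ^ 2 + 8 * (1 + x ^ 2)⁻¹) (.of_forall fun δ ↦ ?_) ?_
      (hint.add (integrable_inv_one_add_sq.const_mul 8)) (.of_forall fun x ↦ ?_)
    · have := Real.continuous_sinc
      exact Continuous.aestronglyMeasurable (by fun_prop)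
    · filter_upwards [hsmall] with δ ⟨hδ, hδ'⟩
      refine .of_forall fun x ↦ ?_
      have h1 : ‖entireSinc (δ * x)‖ ^ 2 ≤ 1 := by
        rw [← ofReal_mul, entireSinc_ofReal, norm_real]
        exact pow_le_one₀ (norm_nonneg _) (Real.abs_sinc_le_one _)
      have h2 := sq_div_pi_mul_sinc_le (b := Real.pi + 4 * δ) (by linarith [Real.pi_gt_three])
        (by linarith [Real.pi_gt_three]) x
      simp only [hF, norm_mul, norm_pow, norm_real, Real.norm_eq_abs] at h1 ⊢
      rw [← abs_mul]
      set p := (Real.pi + 4 * δ) / Real.pi * Real.sinc ((Real.pi + 4 * δ) * x)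
      calc ‖f x‖ * ‖entireSinc (δ * x)‖ ^ 2 * |p| ≤ ‖f x‖ * 1 * |p| := by gcongr
        _ ≤ ‖f x‖ ^ 2 + |p| ^ 2 := by nlinarith [sq_nonneg (‖f x‖ - |p|)]
        _ ≤ _ := by rw [sq_abs]; gcongr
    · have hcont : Continuous fun δ : ℝ ↦ F δ x := by
        have := Real.continuous_sinc
        fun_prop
      refine (hcont.tendsto' 0 _ ?_).mono_left nhdsWithin_le_nhds
      simp [hF, entireSinc_zero, hpi.ne']
  exact tendsto_nhds_unique hlim (tendsto_const_nhds.congr' (hF0.mono fun _ h ↦ h.symm))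

theorem integrable_sinc_pi_mul_sq : Integrable fun x : ℝ ↦ Real.sinc (Real.pi * x) ^ 2 := by
  have hpi := Real.pi_gt_three
  refine (integrable_inv_one_add_sq.const_mul 8).mono'
    ((Real.continuous_sinc.comp (by fun_prop)).pow 2).aestronglyMeasurable
    (.of_forall fun x ↦ ?_)
  rw [Real.norm_of_nonneg (sq_nonneg _)]
  simpa [div_self Real.pi_ne_zero] using
    sq_div_pi_mul_sinc_le (b := Real.pi) (by linarith) (by linarith) x

theorem integral_sinc_pi_mul_sq : ∫ x : ℝ, Real.sinc (Real.pi * x) ^ 2 = 1 := by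
  have hreal : ∀ x : ℝ, entireSinc (Real.pi * x) = Real.sinc (Real.pi * x) := fun x ↦ by
    rw [← ofReal_mul, entireSinc_ofReal]
  have h := integral_mul_sinc_eq (f := fun z ↦ entireSinc (Real.pi * z))
    (differentiable_entireSinc.comp (by fun_prop))
    (by simpa [hreal] using integrable_sinc_pi_mul_sq) fun ε hε ↦ ⟨1, fun z ↦ by
      refine (norm_entireSinc_le _).trans ?_
      rw [im_ofReal_mul, abs_mul, abs_of_pos Real.pi_pos, one_mul]
      gcongr
      linarith⟩
  simp only [hreal, mul_zero, entireSinc_zero] at h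
  simp only [← sq] at h
  exact_mod_cast h

/-- Uniqueness lemma in Lubinsky's second approach: an entire function, real on
`ℝ`, with `f(0) = 1`, `|f| ≤ 1` on `ℝ`, `∫_ℝ |f(x)|² dx ≤ 1`, and of exponential
type at most `π + ε` in `|Im z|` for every `ε > 0`, must be `sin(πz)/(πz)`. -/
theorem lubinsky_uniqueness_sinc
    (f : ℂ → ℂ)
    (hent : Differentiable ℂ f)
    (hreal : ∀ x : ℝ, (f x).im = 0)
    (h0 : f 0 = 1)
    (hbd : ∀ x : ℝ, ‖f x‖ ≤ 1)
    (hint : Integrable (fun x : ℝ => ‖f x‖ ^ 2))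
    (hL2 : ∫ x : ℝ, ‖f x‖ ^ 2 ≤ 1)
    (hgrowth : ∀ ε : ℝ, 0 < ε → ∃ D : ℝ, ∀ z : ℂ,
      ‖f z‖ ≤ D * Real.exp ((Real.pi + ε) * |z.im|)) :
    ∀ z : ℂ, (Real.pi : ℂ) * z * f z = Complex.sin ((Real.pi : ℂ) * z) := by
  set s : ℝ → ℝ := fun x ↦ Real.sinc (Real.pi * x) with hs
  have hsc : Continuous s := Real.continuous_sinc.comp (by fun_prop)
  have hfc : Continuous fun x : ℝ ↦ (f x).re :=
    continuous_re.comp (hent.continuous.comp continuous_ofReal)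
  have hfre : ∀ x : ℝ, f x = ((f x).re : ℂ) := fun x ↦ Complex.ext rfl (by simpa using hreal x)
  have hnorm : ∀ x : ℝ, ‖f x‖ ^ 2 = (f x).re ^ 2 := fun x ↦ by
    rw [hfre x, norm_real, Real.norm_eq_abs, sq_abs, ofReal_re]
  simp only [hnorm] at hL2
  have hint' : Integrable fun x : ℝ ↦ (f x).re ^ 2 := by simpa only [hnorm] using hint
  have hcross : ∫ x : ℝ, (f x).re * s x = 1 := by
    have := integral_mul_sinc_eq hent hint hgrowth
    rw [h0, integral_congr_ae (g := fun x : ℝ ↦ (((f x).re * s x : ℝ) : ℂ))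
      (.of_forall fun x ↦ by simp only [hs]; rw [hfre x]; simp), integral_complex_ofReal] at this
    exact_mod_cast this
  have hcrossint : Integrable fun x : ℝ ↦ (f x).re * s x := by
    by_contra h
    simp [integral_undef h] at hcross
  have hsint : Integrable fun x ↦ s x ^ 2 := integrable_sinc_pi_mul_sq
  have hdist : (fun x : ℝ ↦ ((f x).re - s x) ^ 2) =
      fun x : ℝ ↦ (f x).re ^ 2 - 2 * ((f x).re * s x) + s x ^ 2 := by
    ext x; ring
  have hsub : Integrable fun x : ℝ ↦ (f x).re ^ 2 - 2 * ((f x).re * s x) :=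
    hint'.sub (hcrossint.const_mul 2)
  have hdistint : Integrable fun x : ℝ ↦ ((f x).re - s x) ^ 2 := by
    rw [hdist]
    exact hsub.add hsint
  have hdist0 : ∫ x : ℝ, ((f x).re - s x) ^ 2 = 0 := by
    refine le_antisymm ?_ (integral_nonneg fun x ↦ sq_nonneg _)
    rw [hdist, integral_add hsub hsint,
      integral_sub hint' (hcrossint.const_mul 2), integral_const_mul, hcross,
      integral_sinc_pi_mul_sq]
    linarith
  have hae := (integral_eq_zero_iff_of_nonneg (fun x ↦ sq_nonneg _) hdistint).mp hdist0
  have heq : (fun x : ℝ ↦ ((f x).re - s x) ^ 2) = 0 :=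
    (Continuous.ae_eq_iff_eq volume (by fun_prop) continuous_const).mp hae
  have hline : ∀ x : ℝ, f x = entireSinc (Real.pi * x) := fun x ↦ by
    have : (f x).re = s x := by simpa [sub_eq_zero] using congrFun heq x
    rw [hfre x, this, ← ofReal_mul, entireSinc_ofReal]
  have hfreq : ∃ᶠ z : ℂ in 𝓝[≠] 0, f z = entireSinc (Real.pi * z) := by
    have htend : Tendsto (fun x : ℝ ↦ (x : ℂ)) (𝓝[≠] 0) (𝓝[≠] 0) :=
      tendsto_nhdsWithin_of_tendsto_nhds_of_eventually_within _
        ((continuous_ofReal.tendsto' 0 0 ofReal_zero).mono_left nhdsWithin_le_nhds)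
        (eventually_mem_nhdsWithin.mono fun x hx ↦ by simpa using hx)
    exact htend.frequently (Eventually.of_forall hline).frequently
  have hsd : Differentiable ℂ fun z ↦ entireSinc (Real.pi * z) :=
    differentiable_entireSinc.comp (by fun_prop)
  have hfs := AnalyticOnNhd.eqOn_of_preconnected_of_frequently_eq
    (analyticOnNhd_univ_iff_differentiable.mpr hent)
    (analyticOnNhd_univ_iff_differentiable.mpr hsd)
    isPreconnected_univ (mem_univ 0) hfreq
  intro z
  rw [hfs (mem_univ z), mul_entireSinc]
end
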